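/- arXiv:2407.02132 — 5 statements merged into one kernel-verified Lean document; each statement's English description precedes it below -/
import Mathlib

section
/- Let 0 < q < 1 and β ≥ 1 be real numbers, let V be a real inner product space with inner product ⟪·,·⟫ and norm ‖·‖, and let S ⊆ V be a subset closed under scalar multiplication by natural numbers (if μ ∈ S and m ∈ ℕ then m • μ ∈ S). Then for every λ ∈ S the following are equivalent: (i) there exists a constant C > 0 such that q^(−⟪λ,μ⟫) ≤ C · β^(‖μ‖) for all μ ∈ S; (ii) q^(−‖λ‖) ≤ β. -/
open scoped RealInnerProductSpace

/-- The analytic core of Theorem 4.6: for `0 < q < 1`, `β ≥ 1`, and a subset `S` of a real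
inner product space closed under scalar multiplication by natural numbers, and `λ ∈ S`,
the condition `∃ C > 0, ∀ μ ∈ S, q^(-⟪λ,μ⟫) ≤ C * β^(‖μ‖)` is equivalent to
`q^(-‖λ‖) ≤ β`. -/
theorem stmt0 {V : Type*} [NormedAddCommGroup V] [InnerProductSpace ℝ V]
    (q β : ℝ) (hq0 : 0 < q) (hq1 : q < 1) (hβ : 1 ≤ β)
    (S : Set V) (hS : ∀ μ ∈ S, ∀ m : ℕ, m • μ ∈ S)
    (lam : V) (hlam : lam ∈ S) :
    (∃ C : ℝ, 0 < C ∧ ∀ μ ∈ S, q ^ (-⟪lam, μ⟫) ≤ C * β ^ ‖μ‖) ↔ q ^ (-‖lam‖) ≤ β := by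
  constructor
  · rintro ⟨C, -, h⟩
    by_contra! hlt
    have hβ0 : 0 < β := one_pos.trans_le hβ
    have hnorm : 0 < ‖lam‖ := by
      refine (norm_nonneg lam).lt_of_ne fun h0 => ?_
      rw [← h0, neg_zero, Real.rpow_zero] at hlt
      exact hlt.not_ge hβ
    have hratio : 1 < (q ^ (-‖lam‖) / β) ^ ‖lam‖ :=
      Real.one_lt_rpow ((one_lt_div hβ0).2 hlt) hnorm
    obtain ⟨m, hm⟩ := pow_unbounded_of_one_lt C hratio
    refine hm.not_ge ?_
    have hbound := h (m • lam) (hS lam hlam m)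
    have hinner : -⟪lam, m • lam⟫ = -‖lam‖ * (‖lam‖ * m) := by
      rw [← Nat.cast_smul_eq_nsmul ℝ, real_inner_smul_right, real_inner_self_eq_norm_sq]
      ring
    have hnsmul : ‖m • lam‖ = ‖lam‖ * m := by
      rw [← Nat.cast_smul_eq_nsmul ℝ, norm_smul, Real.norm_natCast, mul_comm]
    rw [hinner, hnsmul, Real.rpow_mul hq0.le] at hbound
    rwa [← Real.rpow_mul_natCast (by positivity), Real.div_rpow (by positivity) hβ0.le,
      div_le_iff₀ (by positivity)]
  · intro h
    refine ⟨1, one_pos, fun μ _ => ?_⟩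
    calc q ^ (-⟪lam, μ⟫) ≤ q ^ (-‖lam‖ * ‖μ‖) := by
          refine Real.rpow_le_rpow_of_exponent_ge hq0 hq1.le ?_
          linarith [real_inner_le_norm lam μ]
      _ = (q ^ (-‖lam‖)) ^ ‖μ‖ := Real.rpow_mul hq0.le _ _
      _ ≤ β ^ ‖μ‖ := by gcongr
      _ = 1 * β ^ ‖μ‖ := (one_mul _).symm
end

section
/- Let V be a real inner product space with inner product ⟪·,·⟫, let N be a natural number, and let α : Fin N → V be a finite family of vectors. Let λ, μ, ρ, ν ∈ V and n : Fin N → ℕ satisfy ν = λ + μ − Σ_j n_j • α_j, and assume ⟪ν, α_j⟫ ≥ 0, ⟪ρ, α_j⟫ ≥ 0, and ⟪λ + μ, α_j⟫ ≥ 0 for all j. Then ⟪ν, ν + 2•ρ⟫ ≤ ⟪λ + μ, λ + μ + 2•ρ⟫. -/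
open scoped RealInnerProductSpace

/-- A vector pairing nonnegatively with each `α j` pairs nonnegatively with any combination of
the `α j` with natural number coefficients. -/
theorem inner_sum_natCast_smul_nonneg {V ι : Type*} [NormedAddCommGroup V]
    [InnerProductSpace ℝ V] [Fintype ι] {α : ι → V} {x : V} (n : ι → ℕ)
    (hx : ∀ j, 0 ≤ ⟪x, α j⟫) : 0 ≤ ⟪x, ∑ j, (n j : ℝ) • α j⟫ := by
  simp only [inner_sum, real_inner_smul_right]
  exact Finset.sum_nonneg fun j _ => mul_nonneg (n j).cast_nonneg (hx j)

/-- Key inequality in the proof of Lemma 4.4: if `ν = λ + μ - ∑ n_j • α_j` with `n_j ∈ ℕ`,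
and `⟪ν, α_j⟫ ≥ 0`, `⟪ρ, α_j⟫ ≥ 0`, `⟪λ + μ, α_j⟫ ≥ 0` for all `j`, then
`⟪ν, ν + 2ρ⟫ ≤ ⟪λ + μ, λ + μ + 2ρ⟫`. -/
theorem stmt3 {V : Type*} [NormedAddCommGroup V] [InnerProductSpace ℝ V]
    (N : ℕ) (α : Fin N → V) (lam μ ρ ν : V) (n : Fin N → ℕ)
    (hν : ν = lam + μ - ∑ j, (n j : ℝ) • α j)
    (hνdom : ∀ j, 0 ≤ ⟪ν, α j⟫)
    (hρdom : ∀ j, 0 ≤ ⟪ρ, α j⟫)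
    (hlmdom : ∀ j, 0 ≤ ⟪lam + μ, α j⟫) :
    ⟪ν, ν + (2 : ℝ) • ρ⟫ ≤ ⟪lam + μ, lam + μ + (2 : ℝ) • ρ⟫ := by
  have hνβ := inner_sum_natCast_smul_nonneg n hνdom
  have hρβ := inner_sum_natCast_smul_nonneg n hρdom
  have hκβ := inner_sum_natCast_smul_nonneg n hlmdom
  set β := ∑ j, (n j : ℝ) • α j
  obtain rfl : lam = ν + β - μ := by rw [hν]; abel
  simp only [sub_add_cancel, inner_add_left, inner_add_right, real_inner_smul_right] at *
  linarith [real_inner_comm β ν, real_inner_comm β ρ]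
end

section
/- Let V be a real inner product space with inner product ⟪·,·⟫, let N be a natural number, and let α : Fin N → V be a finite family of vectors. Let 0 < q < 1 and let λ, μ, ρ ∈ V satisfy ⟪λ, α_j⟫ ≥ 0, ⟪μ, α_j⟫ ≥ 0, and ⟪ρ, α_j⟫ ≥ 0 for all j. Then q^(−2⟪λ,μ⟫) is the greatest element of the set { q^(⟪μ, μ+2•ρ⟫ + ⟪λ, λ+2•ρ⟫ − ⟪ν, ν+2•ρ⟫) : ν ∈ V, ν = λ + μ − Σ_j n_j • α_j for some n : Fin N → ℕ, and ⟪ν, α_j⟫ ≥ 0 for all j }. -/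
open scoped RealInnerProductSpace

/-- A vector pairing nonnegatively with each `α j` pairs nonnegatively with every
nonnegative linear combination of the `α j`. -/
theorem inner_sum_smul_nonneg {V ι : Type*} [NormedAddCommGroup V] [InnerProductSpace ℝ V]
    [Fintype ι] {α : ι → V} {x : V} {c : ι → ℝ} (hx : ∀ j, 0 ≤ ⟪x, α j⟫) (hc : ∀ j, 0 ≤ c j) :
    0 ≤ ⟪x, ∑ j, c j • α j⟫ := by
  simp only [inner_sum, real_inner_smul_right]
  exact Finset.sum_nonneg fun j _ => mul_nonneg (hc j) (hx j)

/-- The supremum computation in the proof of Lemma 4.4: for `0 < q < 1` and dominant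
`λ, μ, ρ`, the value `q^(-2⟪λ,μ⟫)` is the greatest element of the set of all values
`q^(⟪μ,μ+2ρ⟫ + ⟪λ,λ+2ρ⟫ - ⟪ν,ν+2ρ⟫)` where `ν` is dominant and of the form
`λ + μ - ∑ n_j • α_j` with `n_j ∈ ℕ`. -/
theorem stmt4 {V : Type*} [NormedAddCommGroup V] [InnerProductSpace ℝ V]
    (N : ℕ) (α : Fin N → V) (q : ℝ) (hq0 : 0 < q) (hq1 : q < 1)
    (lam μ ρ : V)
    (hlam : ∀ j, 0 ≤ ⟪lam, α j⟫)
    (hμ : ∀ j, 0 ≤ ⟪μ, α j⟫)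
    (hρ : ∀ j, 0 ≤ ⟪ρ, α j⟫) :
    IsGreatest
      {x : ℝ | ∃ ν : V,
        (∃ n : Fin N → ℕ, ν = lam + μ - ∑ j, (n j : ℝ) • α j) ∧
        (∀ j, 0 ≤ ⟪ν, α j⟫) ∧
        x = q ^ (⟪μ, μ + (2 : ℝ) • ρ⟫ + ⟪lam, lam + (2 : ℝ) • ρ⟫ - ⟪ν, ν + (2 : ℝ) • ρ⟫)}
      (q ^ (-(2 * ⟪lam, μ⟫))) := by
  refine ⟨⟨lam + μ, ⟨0, by simp⟩, fun j => ?_, ?_⟩, ?_⟩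
  · rw [inner_add_left]
    exact add_nonneg (hlam j) (hμ j)
  · congr 1
    simp only [inner_add_left, inner_add_right, real_inner_smul_right, real_inner_comm lam μ]
    ring
  · rintro x ⟨ν, ⟨n, hn⟩, hν, rfl⟩
    apply Real.rpow_le_rpow_of_exponent_ge hq0 hq1.le
    set β := ∑ j, (n j : ℝ) • α j with hβ
    have h₁ : 0 ≤ ⟪lam, β⟫ := inner_sum_smul_nonneg hlam fun j => (n j).cast_nonneg
    have h₂ : 0 ≤ ⟪μ, β⟫ := inner_sum_smul_nonneg hμ fun j => (n j).cast_nonneg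
    have h₃ : 0 ≤ ⟪ρ, β⟫ := inner_sum_smul_nonneg hρ fun j => (n j).cast_nonneg
    have h₄ : 0 ≤ ⟪ν, β⟫ := inner_sum_smul_nonneg hν fun j => (n j).cast_nonneg
    clear_value β
    subst hn
    simp only [inner_add_left, inner_add_right, inner_sub_left, inner_sub_right,
      real_inner_smul_right, real_inner_comm lam μ, real_inner_comm lam β,
      real_inner_comm μ β, real_inner_comm ρ β] at *
    linarith
end

section
/- Let V be a real inner product space with inner product ⟪·,·⟫ and norm ‖·‖, let N be a natural number, and let α : Fin N → V be a finite family of vectors. Let λ, μ, ν ∈ V and n : Fin N → ℕ satisfy ν = λ + μ − Σ_j n_j • α_j and ⟪ν, α_j⟫ ≥ 0 for all j. Then ‖ν‖ ≤ ‖λ‖ + ‖μ‖. -/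
open scoped RealInnerProductSpace

/-- Adding a vector at a non-obtuse angle does not decrease the norm. -/
theorem norm_le_norm_add_of_inner_nonneg {V : Type*} [NormedAddCommGroup V]
    [InnerProductSpace ℝ V] {x y : V} (h : 0 ≤ ⟪x, y⟫) : ‖x‖ ≤ ‖x + y‖ := by
  refine (sq_le_sq₀ (norm_nonneg _) (norm_nonneg _)).mp ?_
  rw [norm_add_sq_real]
  nlinarith [sq_nonneg ‖y‖]

/-- Essential content of Proposition 4.5: if `ν = λ + μ - ∑ n_j • α_j` with `n_j ∈ ℕ` and
`⟪ν, α_j⟫ ≥ 0` for all `j`, then `‖ν‖ ≤ ‖λ‖ + ‖μ‖`. -/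
theorem stmt5 {V : Type*} [NormedAddCommGroup V] [InnerProductSpace ℝ V]
    (N : ℕ) (α : Fin N → V) (lam μ ν : V) (n : Fin N → ℕ)
    (hν : ν = lam + μ - ∑ j, (n j : ℝ) • α j)
    (hνdom : ∀ j, 0 ≤ ⟪ν, α j⟫) :
    ‖ν‖ ≤ ‖lam‖ + ‖μ‖ := by
  have h : 0 ≤ ⟪ν, ∑ j, (n j : ℝ) • α j⟫ := by
    simp only [inner_sum, real_inner_smul_right]
    exact Finset.sum_nonneg fun j _ => mul_nonneg (n j).cast_nonneg (hνdom j)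
  calc ‖ν‖ ≤ ‖ν + ∑ j, (n j : ℝ) • α j‖ := norm_le_norm_add_of_inner_nonneg h
    _ = ‖lam + μ‖ := by rw [hν, sub_add_cancel]
    _ ≤ ‖lam‖ + ‖μ‖ := norm_add_le _ _
end

section
/- Let V be a real inner product space with inner product ⟪·,·⟫ and norm ‖·‖, let N be a natural number, and let α : Fin N → V be a finite family of vectors. Let β ≥ 1 be a real number, and let λ, μ, ν ∈ V and n : Fin N → ℕ satisfy ν = λ + μ − Σ_j n_j • α_j and ⟪ν, α_j⟫ ≥ 0 for all j. Then β^(‖ν‖) ≤ β^(‖λ‖) · β^(‖μ‖), and moreover β^(‖ν‖) ≥ 1. -/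
open scoped RealInnerProductSpace

/-- Conditions Z1 and Z2 for the central weight `w_β(μ) = β^(‖μ‖)` (Proposition 4.5):
if `β ≥ 1`, `ν = λ + μ - ∑ n_j • α_j` with `n_j ∈ ℕ` and `⟪ν, α_j⟫ ≥ 0` for all `j`,
then `β^(‖ν‖) ≤ β^(‖λ‖) · β^(‖μ‖)` and `β^(‖ν‖) ≥ 1`. -/
theorem stmt6 {V : Type*} [NormedAddCommGroup V] [InnerProductSpace ℝ V]
    (N : ℕ) (α : Fin N → V) (β : ℝ) (hβ : 1 ≤ β)
    (lam μ ν : V) (n : Fin N → ℕ)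
    (hν : ν = lam + μ - ∑ j, (n j : ℝ) • α j)
    (hνdom : ∀ j, 0 ≤ ⟪ν, α j⟫) :
    β ^ ‖ν‖ ≤ β ^ ‖lam‖ * β ^ ‖μ‖ ∧ 1 ≤ β ^ ‖ν‖ := by
  have hsum : 0 ≤ ⟪ν, ∑ j, (n j : ℝ) • α j⟫ := by
    rw [inner_sum]
    refine Finset.sum_nonneg fun j _ => ?_
    rw [real_inner_smul_right]
    exact mul_nonneg (Nat.cast_nonneg _) (hνdom j)
  have hadd : ν + ∑ j, (n j : ℝ) • α j = lam + μ := by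
    rw [hν, sub_add_cancel]
  have hnorm : ‖ν‖ ≤ ‖lam‖ + ‖μ‖ :=
    calc ‖ν‖ ≤ ‖lam + μ‖ := hadd ▸ norm_le_norm_add_of_inner_nonneg hsum
      _ ≤ ‖lam‖ + ‖μ‖ := norm_add_le _ _
  refine ⟨?_, Real.one_le_rpow hβ (norm_nonneg _)⟩
  rw [← Real.rpow_add (zero_lt_one.trans_le hβ)]
  exact Real.rpow_le_rpow_of_exponent_le hβ hnorm
end
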